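/- Let J be a real analytic almost complex structure on a neighborhood of 0 in ℝ^{2n} with J(0) = J₀ and M = {φ = 0} with 0 ∈ M, and assume M is Levi flat, i.e. 𝓛̂_φ(X,Y) vanishes at every point of M for all real analytic vector fields X, Y lying in T^JM. Then there is a neighborhood V of 0 such that for every p ∈ M ∩ V and every vector v ∈ ℝ^{2n} with dφ_p(v) = 0 and dφ_p(J(p)v) = 0, there exist ρ > 0 and a real analytic J-holomorphic map γ : {ζ ∈ ℂ : |ζ| < ρ} → ℝ^{2n} with γ(0) = p, ∂γ/∂x(0) = v, and γ({|ζ| < ρ}) ⊆ M. -/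

import Mathlib

noncomputable section

open Metric

/-- `ℝ^{2n}` identified with `ℂ^n`. -/
abbrev Ecx (n : ℕ) := EuclideanSpace ℂ (Fin n)

/-- The standard complex structure `J₀` (multiplication by `i`), as a real-linear map. -/
def J0 (n : ℕ) : Ecx n →L[ℝ] Ecx n := Complex.I • ContinuousLinearMap.id ℝ (Ecx n)

variable {F : Type*} [NormedAddCommGroup F] [NormedSpace ℝ F]

/-- `J`-holomorphy of `γ` on a set `D ⊆ ℂ`: `dγ(ζ) ∘ J_st = J(γ ζ) ∘ dγ(ζ)`. -/
def JHolOn (J : F → F →L[ℝ] F) (D : Set ℂ) (γ : ℂ → F) : Prop :=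
  ∀ ζ ∈ D, ∀ v : ℂ, fderiv ℝ γ ζ (Complex.I * v) = J (γ ζ) (fderiv ℝ γ ζ v)


/-- Lie bracket of vector fields: `[X,Y](p) = dY(p)(X(p)) − dX(p)(Y(p))`. -/
def lieVF (X Y : F → F) : F → F :=
  fun p => fderiv ℝ Y p (X p) - fderiv ℝ X p (Y p)

/-- The vector field `JX : x ↦ J(x) X(x)`. -/
def Jvf (J : F → F →L[ℝ] F) (X : F → F) : F → F := fun p => J p (X p)

/-- The flat covariant derivative `X · Y : p ↦ dY(p)(X(p))`. -/
def derVF (X Y : F → F) : F → F := fun p => fderiv ℝ Y p (X p)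

/-- `DX X Y k = D_X^{k,0} Y = X·(X·(⋯(X·Y)))` (`k` times). -/
def DX (X Y : F → F) : ℕ → (F → F)
  | 0 => Y
  | k + 1 => derVF X (DX X Y k)

/-- `applyVF [X₁,…,X_k] Z = X₁·(X₂·(⋯(X_k·Z)))`. -/
def applyVF : List (F → F) → (F → F) → (F → F)
  | [], Z => Z
  | Y :: rest, Z => derVF Y (applyVF rest Z)

/-- `nestedLie [X₁,…,X_k] Z = [X₁,[X₂,[…,[X_k, Z]…]]]`. -/
def nestedLie : List (F → F) → (F → F) → (F → F)
  | [], Z => Z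
  | Y :: rest, Z => lieVF Y (nestedLie rest Z)

/-- Selector for elements of `{X, JX}`: `pickVF X JX true = X`, `pickVF X JX false = JX`. -/
def pickVF (X Y : F → F) (b : Bool) : F → F := if b then X else Y

/-- `X` commutes at order `k` at `p`: all iterated Lie brackets of length `l` with
`2 ≤ l ≤ k` of elements of `{X, JX}` vanish at `p`. -/
def CommutesAtOrder (J : F → F →L[ℝ] F) (X : F → F) (k : ℕ) (p : F) : Prop :=
  ∀ m : ℕ, 1 ≤ m → m + 1 ≤ k → ∀ b : Fin m → Bool, ∀ c : Bool,
    nestedLie (List.ofFn fun i => pickVF X (Jvf J X) (b i))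
      (pickVF X (Jvf J X) c) p = 0


/-- A vector field lies in `T^J M` (with `M = {φ = 0}` inside `U`). -/
def InTJM (J : F → F →L[ℝ] F) (φ : F → ℝ) (U : Set F) (X : F → F) : Prop :=
  ∀ q ∈ U, φ q = 0 → fderiv ℝ φ q (X q) = 0 ∧ fderiv ℝ φ q (J q (X q)) = 0


/-- The polar Levi form
`𝓛̂_φ(X,Y) = dφ(J[X,JY] + J[Y,JX]) + i·dφ(J[X,Y] + J[JX,JY])`. -/
def levihat (J : F → F →L[ℝ] F) (φ : F → ℝ) (X Y : F → F) (q : F) : ℂ :=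
  ((fderiv ℝ φ q (J q (lieVF X (Jvf J Y) q + lieVF Y (Jvf J X) q)) : ℝ) : ℂ) +
  Complex.I * ((fderiv ℝ φ q (J q (lieVF X Y q + lieVF (Jvf J X) (Jvf J Y) q)) : ℝ) : ℂ)

/-- Absolutely summable families indexed by `ℕ × ℕ`, regarded as formal power series in two
variables `x`, `y` in which the monomial `x ^ j * y ^ k` has norm `((j + k).choose j)⁻¹`. -/
def WSeries : Type := lp (fun _ : ℕ × ℕ => ℝ) 1

namespace WSeries

instance : NormedAddCommGroup WSeries :=
  inferInstanceAs (NormedAddCommGroup (lp (fun _ : ℕ × ℕ => ℝ) 1))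

instance : NormedSpace ℝ WSeries :=
  inferInstanceAs (NormedSpace ℝ (lp (fun _ : ℕ × ℕ => ℝ) 1))

instance : CompleteSpace WSeries :=
  inferInstanceAs (CompleteSpace (lp (fun _ : ℕ × ℕ => ℝ) 1))

/-- The norm of a monomial. -/
def wt (i : ℕ × ℕ) : ℝ := ((i.1 + i.2).choose i.1 : ℝ)⁻¹

/-- The monomial `x ^ i.1 * y ^ i.2`. -/
def mono (i : ℕ × ℕ) : WSeries := lp.single (E := fun _ : ℕ × ℕ => ℝ) 1 i (wt i)

theorem wt_pos (i : ℕ × ℕ) : 0 < wt i :=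
  inv_pos.2 (Nat.cast_pos.2 (Nat.choose_pos (Nat.le_add_right _ _)))

theorem wt_zero : wt 0 = 1 := by simp [wt]

theorem norm_mono (i : ℕ × ℕ) : ‖mono i‖ = wt i :=
  (lp.norm_single (E := fun _ : ℕ × ℕ => ℝ) zero_lt_one i (wt i)).trans
    (Real.norm_of_nonneg (wt_pos i).le)

theorem wt_add_le (i l : ℕ × ℕ) : wt (i + l) ≤ wt i * wt l := by
  unfold wt
  rw [← mul_inv]
  have hpos (i : ℕ × ℕ) : 0 < ((i.1 + i.2).choose i.1 : ℝ) :=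
    Nat.cast_pos.2 (Nat.choose_pos (Nat.le_add_right _ _))
  refine inv_anti₀ (mul_pos (hpos i) (hpos l)) ?_
  have h : (i + l).1 + (i + l).2 = (i.1 + i.2) + (l.1 + l.2) := by
    simp only [Prod.fst_add, Prod.snd_add]; omega
  rw [h, Nat.add_choose_eq (i.1 + i.2)]
  exact_mod_cast Finset.single_le_sum
    (f := fun ij : ℕ × ℕ => (i.1 + i.2).choose ij.1 * (l.1 + l.2).choose ij.2)
    (fun _ _ => Nat.zero_le _)
    (by simp : (i.1, l.1) ∈ Finset.HasAntidiagonal.antidiagonal (i + l).1)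

theorem one_half_pow_le_wt (i : ℕ × ℕ) : (1 / 2 : ℝ) ^ (i.1 + i.2) ≤ wt i := by
  rw [one_div, inv_pow]
  refine inv_anti₀ (Nat.cast_pos.2 (Nat.choose_pos (Nat.le_add_right _ _))) ?_
  exact_mod_cast Nat.choose_le_two_pow _ _

variable {G : Type*} [NormedAddCommGroup G] [NormedSpace ℝ G]

theorem summable_abs (a : WSeries) : Summable fun i => |a.1 i| := by
  simpa using (lp.memℓp a).summable (by simp)

theorem norm_eq_tsum (a : WSeries) : ‖a‖ = ∑' i, |a.1 i| := by
  have h := lp.norm_eq_tsum_rpow (p := 1) (by simp) a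
  simp only [ENNReal.toReal_one, Real.rpow_one, div_one, Real.norm_eq_abs] at h
  exact h

theorem hasSum_mono (a : WSeries) : HasSum (fun i => (a.1 i * (wt i)⁻¹) • mono i) a := by
  have h := lp.hasSum_single (E := fun _ : ℕ × ℕ => ℝ) (p := 1) (by simp) a
  have key (i : ℕ × ℕ) : lp.single (E := fun _ : ℕ × ℕ => ℝ) 1 i (a.1 i) =
      (a.1 i * (wt i)⁻¹) • lp.single (E := fun _ : ℕ × ℕ => ℝ) 1 i (wt i) := by
    rw [← lp.single_smul, smul_eq_mul, mul_assoc, inv_mul_cancel₀ (wt_pos i).ne', mul_one]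
  exact (funext key : (fun i => lp.single (E := fun _ : ℕ × ℕ => ℝ) 1 i (a.1 i)) = _) ▸ h

/-- Continuous linear maps agreeing on monomials are equal. -/
theorem clm_ext {S T : WSeries →L[ℝ] G} (h : ∀ i, S (mono i) = T (mono i)) : S = T := by
  ext a
  have hS := (hasSum_mono a).mapL S
  have hT := (hasSum_mono a).mapL T
  simp only [map_smul, h] at hS hT
  exact hS.unique hT

theorem norm_lift_term_le {g : ℕ × ℕ → G} {C : ℝ} (hg : ∀ i, ‖g i‖ ≤ C * wt i) (a : WSeries)
    (i : ℕ × ℕ) : ‖(a.1 i * (wt i)⁻¹) • g i‖ ≤ C * |a.1 i| := by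
  rw [norm_smul, norm_mul, norm_inv, Real.norm_of_nonneg (wt_pos i).le, Real.norm_eq_abs]
  calc |a.1 i| * (wt i)⁻¹ * ‖g i‖ ≤ |a.1 i| * (wt i)⁻¹ * (C * wt i) := by
        gcongr
        · have := wt_pos i; positivity
        · exact hg i
    _ = C * |a.1 i| := by have := (wt_pos i).ne'; field_simp

variable [CompleteSpace G]

theorem summable_lift {g : ℕ × ℕ → G} {C : ℝ} (hg : ∀ i, ‖g i‖ ≤ C * wt i) (a : WSeries) :
    Summable fun i => (a.1 i * (wt i)⁻¹) • g i :=
  .of_norm_bounded ((summable_abs a).mul_left C) (norm_lift_term_le hg a)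

/-- The continuous linear map with prescribed values on monomials. -/
def lift (g : ℕ × ℕ → G) (C : ℝ) (hg : ∀ i, ‖g i‖ ≤ C * wt i) : WSeries →L[ℝ] G :=
  LinearMap.mkContinuous
    { toFun := fun a => ∑' i, (a.1 i * (wt i)⁻¹) • g i
      map_add' := fun a b => by
        rw [← (summable_lift hg a).tsum_add (summable_lift hg b)]
        refine tsum_congr fun i => ?_
        rw [← add_smul, ← add_mul]
        rfl
      map_smul' := fun c a => by
        rw [RingHom.id_apply, ← (summable_lift hg a).tsum_const_smul c]
        refine tsum_congr fun i => ?_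
        rw [smul_smul, ← mul_assoc]
        rfl } C fun a => by
    rw [norm_eq_tsum, ← tsum_mul_left]
    exact tsum_of_norm_bounded ((summable_abs a).mul_left C).hasSum (norm_lift_term_le hg a)

theorem lift_mono (g : ℕ × ℕ → G) (C : ℝ) (hg : ∀ i, ‖g i‖ ≤ C * wt i) (i : ℕ × ℕ) :
    lift g C hg (mono i) = g i := by
  change ∑' j, ((mono i).1 j * (wt j)⁻¹) • g j = g i
  rw [tsum_eq_single i]
  · change ((Pi.single i (wt i) : ℕ × ℕ → ℝ) i * (wt i)⁻¹) • g i = g i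
    rw [Pi.single_eq_same, mul_inv_cancel₀ (wt_pos i).ne', one_smul]
  · intro j hj
    change ((Pi.single i (wt i) : ℕ × ℕ → ℝ) j * (wt j)⁻¹) • g j = 0
    rw [Pi.single_eq_of_ne hj, zero_mul, zero_smul]

theorem norm_lift_le (g : ℕ × ℕ → G) (C : ℝ) (hC : 0 ≤ C) (hg : ∀ i, ‖g i‖ ≤ C * wt i) :
    ‖lift g C hg‖ ≤ C :=
  LinearMap.mkContinuous_norm_le _ hC _

/-- The continuous bilinear map with prescribed values on pairs of monomials. -/
def lift₂ (g : ℕ × ℕ → ℕ × ℕ → G) (hg : ∀ i l, ‖g i l‖ ≤ wt i * wt l) :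
    WSeries →L[ℝ] WSeries →L[ℝ] G :=
  lift (fun i => lift (g i) (wt i) (hg i)) 1 fun i => by
    rw [one_mul]; exact norm_lift_le _ _ (wt_pos i).le _

theorem lift₂_mono (g : ℕ × ℕ → ℕ × ℕ → G) (hg : ∀ i l, ‖g i l‖ ≤ wt i * wt l)
    (i l : ℕ × ℕ) : lift₂ g hg (mono i) (mono l) = g i l := by
  rw [lift₂, lift_mono, lift_mono]

theorem norm_lift₂_le (g : ℕ × ℕ → ℕ × ℕ → G) (hg : ∀ i l, ‖g i l‖ ≤ wt i * wt l) :
    ‖lift₂ g hg‖ ≤ 1 :=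
  norm_lift_le _ _ zero_le_one _

/-- Multiplication of power series. -/
def mulL : WSeries →L[ℝ] WSeries →L[ℝ] WSeries :=
  lift₂ (fun i l => mono (i + l)) fun i l => (norm_mono _).trans_le (wt_add_le i l)

theorem mulL_mono (i l : ℕ × ℕ) : mulL (mono i) (mono l) = mono (i + l) := lift₂_mono _ _ _ _

theorem norm_mulL_le : ‖mulL‖ ≤ 1 := norm_lift₂_le _ _

theorem mulL_comm (a b : WSeries) : mulL a b = mulL b a := by
  have : mulL = mulL.flip := clm_ext fun i => clm_ext fun l => by
    rw [ContinuousLinearMap.flip_apply, mulL_mono, mulL_mono, add_comm]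
  rw [this, ContinuousLinearMap.flip_apply, ← this]

theorem mulL_assoc (a b c : WSeries) : mulL (mulL a b) c = mulL a (mulL b c) := by
  have h : (mulL.flip c).comp (mulL.flip b) = mulL.flip (mulL b c) := clm_ext fun i => by
    have h : (mulL.flip c).comp (mulL (mono i)) = (mulL (mono i)).comp (mulL.flip c) :=
      clm_ext fun l => by
        have h : mulL (mulL (mono i) (mono l)) = (mulL (mono i)).comp (mulL (mono l)) :=
          clm_ext fun k => by simp [mulL_mono, add_assoc]
        simpa using congr($h c)
    simpa using congr($h b)
  simpa using congr($h a)

theorem mulL_one (a : WSeries) : mulL a (mono 0) = a := by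
  have : mulL.flip (mono 0) = ContinuousLinearMap.id ℝ WSeries := clm_ext fun i => by
    simp [mulL_mono]
  simpa using congr($this a)

instance : NormedCommRing WSeries where
  __ := (inferInstance : NormedAddCommGroup WSeries)
  mul a b := mulL a b
  one := mono 0
  left_distrib a b c := map_add (mulL a) b c
  right_distrib a b c := congr($(map_add mulL a b) c)
  zero_mul a := congr($(map_zero mulL) a)
  mul_zero a := map_zero (mulL a)
  mul_assoc := mulL_assoc
  one_mul a := (mulL_comm _ _).trans (mulL_one a)
  mul_one := mulL_one
  mul_comm := mulL_comm
  norm_mul_le a b := by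
    refine ((mulL a).le_opNorm b).trans ?_
    gcongr
    simpa using mulL.le_of_opNorm_le norm_mulL_le a

theorem mul_eq (a b : WSeries) : a * b = mulL a b := rfl

theorem one_eq : (1 : WSeries) = mono 0 := rfl

instance : NormOneClass WSeries := ⟨(norm_mono 0).trans wt_zero⟩

instance : NormedAlgebra ℝ WSeries where
  __ := Algebra.ofModule (R := ℝ) (A := WSeries)
    (fun r a b => congr($(map_smul mulL r a) b)) (fun r a b => map_smul (mulL a) r b)
  norm_smul_le := norm_smul_le

theorem norm_integrate_le (i l : ℕ × ℕ) :
    ‖((l.1 : ℝ) / (i.2 + l.2 + 1)) • mono (i.1 + l.1 - 1, i.2 + l.2 + 1)‖ ≤ wt i * wt l := by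
  refine le_trans ?_ (wt_add_le i l)
  rw [norm_smul, norm_mono]
  obtain ⟨j, k⟩ := i
  obtain ⟨l, m⟩ := l
  rcases l.eq_zero_or_pos with rfl | hl
  · simpa using (wt_pos _).le
  obtain ⟨s, hs⟩ : ∃ s, j + l = s + 1 := ⟨j + l - 1, by omega⟩
  simp only [wt, Prod.mk_add_mk, hs, Nat.add_sub_cancel]
  have key : ((s + 1 + (k + m)).choose (s + 1) : ℝ) * (s + 1) =
      (s + (k + m + 1)).choose s * (k + m + 1) := by
    have h := Nat.choose_succ_right_eq (s + (k + m + 1)) s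
    rw [Nat.add_sub_cancel_left] at h
    rw [show s + 1 + (k + m) = s + (k + m + 1) by omega]
    exact_mod_cast h
  have h1 : 0 < ((s + 1 + (k + m)).choose (s + 1) : ℝ) :=
    Nat.cast_pos.2 (Nat.choose_pos (by omega))
  have h2 : 0 < ((s + (k + m + 1)).choose s : ℝ) := Nat.cast_pos.2 (Nat.choose_pos (by omega))
  have hl' : (l : ℝ) ≤ s + 1 := by exact_mod_cast (by omega : l ≤ s + 1)
  rw [Real.norm_of_nonneg (by positivity), div_mul_eq_mul_div, ← div_eq_mul_inv, div_div,
    ← key, inv_eq_one_div, div_le_div_iff₀ (by positivity) h1]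
  nlinarith

/-- The bilinear operator `(a, b) ↦ ∫₀^y a ∂b/∂x dy`. -/
def integ : WSeries →L[ℝ] WSeries →L[ℝ] WSeries :=
  lift₂ (fun i l => ((l.1 : ℝ) / (i.2 + l.2 + 1)) • mono (i.1 + l.1 - 1, i.2 + l.2 + 1))
    norm_integrate_le

/-- The multilinear form on `(ℝ × ℝ)^N` with diagonal `q ↦ q.1 ^ j * q.2 ^ (N - j)`. -/
def monoForm (N j : ℕ) : ContinuousMultilinearMap ℝ (fun _ : Fin N => ℝ × ℝ) ℝ :=
  (ContinuousMultilinearMap.mkPiAlgebra ℝ (Fin N) ℝ).compContinuousLinearMap fun t =>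
    if t.1 < j then ContinuousLinearMap.fst ℝ ℝ ℝ else ContinuousLinearMap.snd ℝ ℝ ℝ

theorem norm_monoForm_le (N j : ℕ) : ‖monoForm N j‖ ≤ 1 := by
  refine (ContinuousMultilinearMap.norm_compContinuousLinearMap_le _ _).trans ?_
  rw [ContinuousMultilinearMap.norm_mkPiAlgebra, one_mul]
  refine Finset.prod_le_one (fun _ _ => norm_nonneg _) fun t _ => ?_
  split_ifs
  · exact ContinuousLinearMap.norm_fst_le ℝ ℝ ℝ
  · exact ContinuousLinearMap.norm_snd_le ℝ ℝ ℝ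

theorem monoForm_apply (j k : ℕ) (q : ℝ × ℝ) :
    monoForm (j + k) j (fun _ => q) = q.1 ^ j * q.2 ^ k := by
  have h (t : Fin (j + k)) : (if t.1 < j then ContinuousLinearMap.fst ℝ ℝ ℝ
      else ContinuousLinearMap.snd ℝ ℝ ℝ) q = if t.1 < j then q.1 else q.2 := by
    split_ifs <;> rfl
  simp [monoForm, h, Fin.prod_univ_add]

/-- The homogeneous components of the evaluation of a power series at a point. -/
def evalForm (N : ℕ) : WSeries →L[ℝ] ContinuousMultilinearMap ℝ (fun _ : Fin N => ℝ × ℝ) ℝ :=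
  lift (fun i => if i.1 + i.2 = N then monoForm N i.1 else 0) (2 ^ N) fun i => by
    split_ifs with h
    · refine (norm_monoForm_le _ _).trans ?_
      have h1 := one_half_pow_le_wt i
      rw [h, one_div, inv_pow] at h1
      rwa [← inv_le_iff_one_le_mul₀' (by positivity)]
    · have := wt_pos i
      simpa using by positivity

/-- The power series of the evaluation map. -/
def evalSeries : FormalMultilinearSeries ℝ (ℝ × ℝ) (WSeries →L[ℝ] ℝ) :=
  fun N => (evalForm N).flipMultilinear

theorem norm_evalSeries_le (N : ℕ) : ‖evalSeries N‖ ≤ 2 ^ N := by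
  refine ContinuousMultilinearMap.opNorm_le_bound (by positivity) fun m => ?_
  refine ContinuousLinearMap.opNorm_le_bound _ (by positivity) fun a => ?_
  refine ((evalForm N a).le_opNorm m).trans ?_
  rw [mul_right_comm]
  gcongr
  exact (evalForm N).le_of_opNorm_le (norm_lift_le _ _ (by positivity) _) a

theorem le_radius_evalSeries : ((1 / 2 : NNReal) : ENNReal) ≤ evalSeries.radius :=
  evalSeries.le_radius_of_bound 1 fun N => by
    calc ‖evalSeries N‖ * ((1 / 2 : NNReal) : ℝ) ^ N ≤ 2 ^ N * (1 / 2 : ℝ) ^ N := by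
          push_cast
          gcongr
          exact norm_evalSeries_le N
      _ = 1 := by rw [← mul_pow]; norm_num

/-- Evaluation of a power series at a point of `ℝ × ℝ`. -/
def eval (q : ℝ × ℝ) : WSeries →L[ℝ] ℝ := evalSeries.sum q

theorem hasFPowerSeriesOnBall_eval :
    HasFPowerSeriesOnBall eval evalSeries 0 ((1 / 2 : NNReal) : ENNReal) :=
  (evalSeries.hasFPowerSeriesOnBall (lt_of_lt_of_le (by simp) le_radius_evalSeries)).mono
    (by simp) le_radius_evalSeries

theorem mem_eball {q : ℝ × ℝ} (hq : ‖q‖ < 1 / 2) :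
    q ∈ Metric.eball (0 : ℝ × ℝ) ((1 / 2 : NNReal) : ENNReal) := by
  rw [Metric.eball_coe]
  simpa using hq

theorem analyticAt_eval {q : ℝ × ℝ} (hq : ‖q‖ < 1 / 2) : AnalyticAt ℝ eval q :=
  hasFPowerSeriesOnBall_eval.analyticAt_of_mem (mem_eball hq)

theorem eval_mono {q : ℝ × ℝ} (hq : ‖q‖ < 1 / 2) (i : ℕ × ℕ) :
    eval q (mono i) = q.1 ^ i.1 * q.2 ^ i.2 := by
  have h := hasFPowerSeriesOnBall_eval.hasSum (mem_eball hq)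
  rw [zero_add] at h
  have h' := h.mapL (ContinuousLinearMap.apply ℝ ℝ (mono i))
  have key (N : ℕ) : ContinuousLinearMap.apply ℝ ℝ (mono i) (evalSeries N fun _ => q) =
      if N = i.1 + i.2 then q.1 ^ i.1 * q.2 ^ i.2 else 0 := by
    change evalForm N (mono i) (fun _ => q) = _
    rw [evalForm, lift_mono]
    split_ifs with h1 h2 h2
    · subst h1; exact monoForm_apply _ _ _
    · exact absurd h1.symm h2
    · exact absurd h2.symm h1
    · rfl
  simp only [key] at h'
  exact h'.unique (hasSum_ite_eq _ _)

theorem eval_mul {q : ℝ × ℝ} (hq : ‖q‖ < 1 / 2) (a b : WSeries) :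
    eval q (a * b) = eval q a * eval q b := by
  have h : (eval q).comp (mulL.flip b) = eval q b • eval q := clm_ext fun i => by
    have h : (eval q).comp (mulL (mono i)) = eval q (mono i) • eval q := clm_ext fun l => by
      simp [mulL_mono, eval_mono hq]
      ring
    simpa [mul_comm] using congr($h b)
  simpa [mul_comm, mul_eq] using congr($h a)

theorem eval_one {q : ℝ × ℝ} (hq : ‖q‖ < 1 / 2) : eval q 1 = 1 := by
  simp [one_eq, eval_mono hq]

/-- Evaluation as an algebra homomorphism. -/
def evalHom (q : ℝ × ℝ) (hq : ‖q‖ < 1 / 2) : WSeries →ₐ[ℝ] ℝ :=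
  AlgHom.ofLinearMap (eval q) (eval_one hq) (eval_mul hq)

theorem fderiv_eval_mono {q : ℝ × ℝ} (hq : ‖q‖ < 1 / 2) (i : ℕ × ℕ) (v : ℝ × ℝ) :
    fderiv ℝ eval q v (mono i) =
      i.1 * q.1 ^ (i.1 - 1) * v.1 * q.2 ^ i.2 + q.1 ^ i.1 * (i.2 * q.2 ^ (i.2 - 1) * v.2) := by
  have h1 : HasFDerivAt (fun p => eval p (mono i))
      ((ContinuousLinearMap.apply ℝ ℝ (mono i)).comp (fderiv ℝ eval q)) q :=
    (ContinuousLinearMap.apply ℝ ℝ (mono i)).hasFDerivAt.comp q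
      (analyticAt_eval hq).differentiableAt.hasFDerivAt
  have hfst : HasFDerivAt Prod.fst (ContinuousLinearMap.fst ℝ ℝ ℝ) q := hasFDerivAt_fst
  have hsnd : HasFDerivAt Prod.snd (ContinuousLinearMap.snd ℝ ℝ ℝ) q := hasFDerivAt_snd
  have h2 := (hfst.pow i.1).mul (hsnd.pow i.2)
  have h3 : (fun p => eval p (mono i)) =ᶠ[nhds q] fun p => p.1 ^ i.1 * p.2 ^ i.2 := by
    filter_upwards [continuous_norm.continuousAt.eventually_lt continuousAt_const hq] with p hp
    exact eval_mono hp i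
  have h4 := (h1.congr_of_eventuallyEq h3.symm).unique h2
  have h5 := congr($h4 v)
  simp at h5
  rw [h5]; ring

/-- `∂/∂y ∫₀^y a ∂b/∂x dy = a ∂b/∂x`. -/
theorem fderiv_eval_integ {q : ℝ × ℝ} (hq : ‖q‖ < 1 / 2) (a b : WSeries) :
    fderiv ℝ eval q (0, 1) (integ a b) = eval q a * fderiv ℝ eval q (1, 0) b := by
  have h : (fderiv ℝ eval q (0, 1)).comp (integ.flip b) = fderiv ℝ eval q (1, 0) b • eval q :=
    clm_ext fun i => by
      have h : (fderiv ℝ eval q (0, 1)).comp (integ (mono i)) =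
          eval q (mono i) • fderiv ℝ eval q (1, 0) := clm_ext fun l => by
        have h0 : (i.2 + l.2 + 1 : ℝ) ≠ 0 := by positivity
        rcases l.1.eq_zero_or_pos with hl | hl
        · simp [integ, lift₂_mono, fderiv_eval_mono hq, eval_mono hq, hl]
        · simp [integ, lift₂_mono, fderiv_eval_mono hq, eval_mono hq]
          rw [Nat.add_sub_assoc hl]
          field_simp
          ring
      simpa [mul_comm] using congr($h b)
  simpa [mul_comm] using congr($h a)

theorem eval_integ_of_snd_eq_zero {x : ℝ} (hx : ‖(x, (0 : ℝ))‖ < 1 / 2) (a b : WSeries) :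
    eval (x, 0) (integ a b) = 0 := by
  have h : (eval (x, 0)).comp (integ.flip b) = 0 := clm_ext fun i => by
    have h : (eval (x, 0)).comp (integ (mono i)) = 0 := clm_ext fun l => by
      simp [integ, lift₂_mono, eval_mono hx]
    simpa using congr($h b)
  simpa using congr($h a)

theorem norm_eval_le {q : ℝ × ℝ} (hq : ‖q‖ < 1 / 2) : ‖eval q‖ ≤ 1 := by
  have hbd (i : ℕ × ℕ) : ‖q.1 ^ i.1 * q.2 ^ i.2‖ ≤ 1 * wt i := by
    rw [one_mul]
    refine le_trans ?_ (one_half_pow_le_wt i)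
    rw [norm_mul, norm_pow, norm_pow, pow_add]
    gcongr
    · exact (norm_fst_le q).trans hq.le
    · exact (norm_snd_le q).trans hq.le
  have h : eval q = lift _ 1 hbd := clm_ext fun i => by rw [lift_mono, eval_mono hq]
  rw [h]
  exact norm_lift_le _ _ zero_le_one _

end WSeries

section FunctionalCalculus

variable {ι : Type*} [Fintype ι] [DecidableEq ι]
  (A : Type*) [NormedCommRing A] [NormedAlgebra ℝ A]

/-- The power series on `ι → A` with the same coefficients as a power series on `ι → ℝ`. -/
def algebraSeries (P : FormalMultilinearSeries ℝ (ι → ℝ) ℝ) :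
    FormalMultilinearSeries ℝ (ι → A) A := fun m =>
  ∑ s : Fin m → ι, (P m fun k => Pi.single (s k) 1) •
    (ContinuousMultilinearMap.mkPiAlgebra ℝ (Fin m) A).compContinuousLinearMap
      fun k => ContinuousLinearMap.proj (s k)

variable {A}

theorem norm_algebraSeries_le [NormOneClass A] (P : FormalMultilinearSeries ℝ (ι → ℝ) ℝ) (m : ℕ) :
    ‖algebraSeries A P m‖ ≤ (Fintype.card ι : ℝ) ^ m * ‖P m‖ := by
  have h : ∀ s ∈ (Finset.univ : Finset (Fin m → ι)), ‖(P m fun k => Pi.single (s k) 1) •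
      (ContinuousMultilinearMap.mkPiAlgebra ℝ (Fin m) A).compContinuousLinearMap
        (fun k => (ContinuousLinearMap.proj (s k) : (ι → A) →L[ℝ] A))‖ ≤ ‖P m‖ := by
    intro s _
    rw [norm_smul, ← mul_one ‖P m‖]
    gcongr
    · refine ((P m).le_opNorm _).trans ?_
      rw [Finset.prod_eq_one fun k _ => by rw [Pi.norm_single, norm_one], mul_one]
    · refine (ContinuousMultilinearMap.norm_compContinuousLinearMap_le _ _).trans ?_
      rw [ContinuousMultilinearMap.norm_mkPiAlgebra, one_mul]
      refine Finset.prod_le_one (fun _ _ => norm_nonneg _) fun t _ => ?_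
      exact ContinuousLinearMap.opNorm_le_bound _ zero_le_one fun x => by
        simpa using norm_le_pi_norm x (s t)
  simpa [algebraSeries] using (norm_sum_le _ _).trans (Finset.sum_le_card_nsmul _ _ _ h)

theorem map_algebraSeries (P : FormalMultilinearSeries ℝ (ι → ℝ) ℝ) (χ : A →ₐ[ℝ] ℝ) (t : ι → A)
    (m : ℕ) : χ (algebraSeries A P m fun _ => t) = P m fun _ i => χ (t i) := by
  have h : (fun i => χ (t i)) = ∑ i, χ (t i) • (Pi.single i 1 : ι → ℝ) := by
    ext j; simp [Pi.single_apply]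
  rw [h, (P m).map_sum]
  simp [algebraSeries, ContinuousMultilinearMap.map_smul_univ, mul_comm]

/-- Real analytic functions act on small elements of commutative Banach algebras. -/
theorem exists_algebra_extension [NormOneClass A] [CompleteSpace A] {f : (ι → ℝ) → ℝ}
    {p : ι → ℝ} (hf : AnalyticAt ℝ f p) :
    ∃ g : (ι → A) → A, AnalyticAt ℝ g 0 ∧ ∀ᶠ t in nhds (0 : ι → A),
      ∀ χ : A →ₐ[ℝ] ℝ, (∀ a, ‖χ a‖ ≤ ‖a‖) → χ (g t) = f (p + fun i => χ (t i)) := by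
  obtain ⟨P, R, hP⟩ := hf
  obtain ⟨r₀, hr₀, hr₀R⟩ := ENNReal.lt_iff_exists_nnreal_btwn.1 hP.r_pos
  obtain ⟨C, hC, hCP⟩ := P.norm_mul_pow_le_of_lt_radius (hr₀R.trans_le hP.r_le)
  have hr₀' : 0 < r₀ := by exact_mod_cast hr₀
  set r : NNReal := r₀ / (Fintype.card ι + 1) with hr
  have hrpos : 0 < r := by positivity
  have hrle : r ≤ r₀ := div_le_self zero_le (by simp)
  have hrad : (r : ENNReal) ≤ (algebraSeries A P).radius :=
    FormalMultilinearSeries.le_radius_of_bound _ C fun m => by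
      calc ‖algebraSeries A P m‖ * (r : ℝ) ^ m
          ≤ ((Fintype.card ι : ℝ) + 1) ^ m * ‖P m‖ * (r : ℝ) ^ m := by
            gcongr
            refine (norm_algebraSeries_le P m).trans ?_
            gcongr
            simp
        _ = ‖P m‖ * (r₀ : ℝ) ^ m := by
            rw [hr]
            push_cast
            rw [div_pow]
            field_simp
        _ ≤ C := hCP m
  have hball := ((algebraSeries A P).hasFPowerSeriesOnBall
    (lt_of_lt_of_le (by exact_mod_cast hrpos) hrad)).mono (by exact_mod_cast hrpos) hrad
  refine ⟨(algebraSeries A P).sum, hball.analyticAt, ?_⟩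
  filter_upwards [ball_mem_nhds (0 : ι → A) hrpos] with t ht χ hχ
  have h1 := hball.hasSum (y := t) (by rwa [Metric.eball_coe])
  rw [zero_add] at h1
  have hχc : Continuous χ :=
    (LinearMap.mkContinuous χ.toLinearMap 1 fun a => by simpa using hχ a).continuous
  have h2 := h1.map χ hχc
  have h3 : (fun i => χ (t i)) ∈ Metric.eball (0 : ι → ℝ) R := by
    refine Metric.eball_subset_eball (le_trans (by exact_mod_cast hrle) hr₀R.le)
      (?_ : _ ∈ Metric.eball _ (r : ENNReal))
    rw [Metric.eball_coe, mem_ball_zero_iff, pi_norm_lt_iff (by exact_mod_cast hrpos)]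
    intro i
    exact (hχ _).trans_lt ((norm_le_pi_norm t i).trans_lt (by simpa using ht))
  have h4 := hP.hasSum h3
  have h5 : (χ ∘ fun m => algebraSeries A P m fun _ => t) = fun m => P m fun _ i => χ (t i) :=
    funext (map_algebraSeries P χ t)
  rw [h5] at h2
  exact h2.unique h4

end FunctionalCalculus

theorem AnalyticAt.clm_apply_apply {E G H : Type*} [NormedAddCommGroup E] [NormedSpace ℝ E]
    [NormedAddCommGroup G] [NormedSpace ℝ G] [NormedAddCommGroup H] [NormedSpace ℝ H]
    {f : E → G →L[ℝ] H} {g : E → G} {x : E} (hf : AnalyticAt ℝ f x) (hg : AnalyticAt ℝ g x) :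
    AnalyticAt ℝ (fun y => f y (g y)) x :=
  ((ContinuousLinearMap.id ℝ (G →L[ℝ] H)).analyticAt_bilinear (f x, g x)).comp₂ hf hg

open WSeries Filter Topology in
/-- The Cauchy–Kovalevskaya theorem in coordinates. -/
theorem cauchyKovalevskaya_pi {ι : Type*} [Fintype ι] {P : (ι → ℝ) → (ι → ℝ) →L[ℝ] (ι → ℝ)}
    {Q : (ι → ℝ) → (ι → ℝ)} {c : ℝ → ι → ℝ} (hP : AnalyticAt ℝ P (c 0))
    (hQ : AnalyticAt ℝ Q (c 0)) (hc : AnalyticAt ℝ c 0) :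
    ∃ z : ℝ × ℝ → ι → ℝ, AnalyticAt ℝ z 0 ∧ (∀ᶠ x in 𝓝 0, z (x, 0) = c x) ∧
      ∀ᶠ q in 𝓝 0, fderiv ℝ z q (0, 1) = P (z q) (fderiv ℝ z q (1, 0)) + Q (z q) := by
  classical
  have hPij (i j : ι) : AnalyticAt ℝ (fun s => P s (Pi.single j 1) i) (c 0) :=
    analyticAt_pi_iff.1 (hP.clm_apply_apply analyticAt_const) i
  have hQi (i : ι) : AnalyticAt ℝ (fun s => Q s i) (c 0) := analyticAt_pi_iff.1 hQ i
  have hci (i : ι) : AnalyticAt ℝ (fun s : Unit → ℝ => c (s ()) i) 0 :=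
    (analyticAt_pi_iff.1 hc i).comp_of_eq
      ((ContinuousLinearMap.proj (R := ℝ) (φ := fun _ : Unit => ℝ) ()).analyticAt 0) rfl
  choose gP hgP hgPχ using fun i j => exists_algebra_extension (A := WSeries) (hPij i j)
  choose gQ hgQ hgQχ using fun i => exists_algebra_extension (A := WSeries) (hQi i)
  choose gc hgc hgcχ using fun i => exists_algebra_extension (A := WSeries) (hci i)
  set X : WSeries := mono (1, 0) with hX
  set w : ℝ → Unit → WSeries := fun ε _ => ε • X with hw
  set t₀ : ℝ → ι → WSeries := fun ε i => gc i (w ε) - gc i 0 with ht₀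
  have hwc : Tendsto w (𝓝 0) (𝓝 0) := by
    have : Continuous w := by fun_prop
    simpa [hw, Pi.zero_def] using this.tendsto 0
  have ht₀c : Tendsto t₀ (𝓝 0) (𝓝 0) := by
    refine tendsto_pi_nhds.2 fun i => ?_
    simpa [ht₀] using ((hgc i).continuousAt.tendsto.comp hwc).sub_const (gc i 0)
  have hgood : ∀ᶠ t in 𝓝 (0 : ι → WSeries),
      ((∀ i j, AnalyticAt ℝ (gP i j) t) ∧ ∀ i, AnalyticAt ℝ (gQ i) t) ∧
      (∀ i j, ∀ χ : WSeries →ₐ[ℝ] ℝ, (∀ a, ‖χ a‖ ≤ ‖a‖) →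
        χ (gP i j t) = P (c 0 + fun i => χ (t i)) (Pi.single j 1) i) ∧
      ∀ i, ∀ χ : WSeries →ₐ[ℝ] ℝ, (∀ a, ‖χ a‖ ≤ ‖a‖) →
        χ (gQ i t) = Q (c 0 + fun i => χ (t i)) i :=
    ((eventually_all.2 fun i => eventually_all.2 fun j => (hgP i j).eventually_analyticAt).and
      (eventually_all.2 fun i => (hgQ i).eventually_analyticAt)).and
      ((eventually_all.2 fun i => eventually_all.2 fun j => hgPχ i j).and
        (eventually_all.2 fun i => hgQχ i))
  obtain ⟨ε, ⟨hεt, hεc⟩, hε⟩ := (((ht₀c.eventually hgood.eventually_nhds).and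
    (hwc.eventually (eventually_all.2 hgcχ))).filter_mono nhdsWithin_le_nhds |>.and
      (self_mem_nhdsWithin (s := Set.Ioi (0 : ℝ)))).exists
  replace hε : 0 < ε := hε
  set Ψ : (ι → WSeries) → ι → WSeries := fun t i =>
    ∑ j, integ (gP i j t) (t j) + integ (gQ i t) (ε • X) with hΨ
  have hΨan : AnalyticAt ℝ Ψ (t₀ ε) := by
    obtain ⟨⟨h1, h2⟩, -⟩ := hεt.self_of_nhds
    refine analyticAt_pi_iff.2 fun i => ?_
    have hint {g : (ι → WSeries) → WSeries} (hg : AnalyticAt ℝ g (t₀ ε)) :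
        AnalyticAt ℝ (fun t => integ (g t)) (t₀ ε) := (integ.analyticAt _).comp hg
    have hproj (j : ι) : AnalyticAt ℝ (fun t : ι → WSeries => t j) (t₀ ε) :=
      (ContinuousLinearMap.proj (R := ℝ) (φ := fun _ : ι => WSeries) j).analyticAt _
    have hsum : AnalyticAt ℝ (fun t : ι → WSeries => ∑ j, integ (gP i j t) (t j)) (t₀ ε) :=
      Finset.univ.analyticAt_fun_sum fun j _ => (hint (h1 i j)).clm_apply_apply (hproj j)
    exact hsum.add ((hint (h2 i)).clm_apply_apply analyticAt_const)
  obtain ⟨δ, hδ, t, ht, htg⟩ : ∃ δ > (0 : ℝ), ∃ t, t = t₀ ε + δ • Ψ t ∧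
      ((∀ i j, ∀ χ : WSeries →ₐ[ℝ] ℝ, (∀ a, ‖χ a‖ ≤ ‖a‖) →
        χ (gP i j t) = P (c 0 + fun i => χ (t i)) (Pi.single j 1) i) ∧
      ∀ i, ∀ χ : WSeries →ₐ[ℝ] ℝ, (∀ a, ‖χ a‖ ≤ ‖a‖) →
        χ (gQ i t) = Q (c 0 + fun i => χ (t i)) i) := by
    have hfst := hasStrictFDerivAt_fst (𝕜 := ℝ) (E := ι → WSeries) (p := (t₀ ε, (0 : ℝ)))
    have hsnd := hasStrictFDerivAt_snd (𝕜 := ℝ) (E := ι → WSeries) (p := (t₀ ε, (0 : ℝ)))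
    have hΨ' := hΨan.hasStrictFDerivAt.comp (t₀ ε, (0 : ℝ)) hfst
    have hH := (hfst.sub (hsnd.smul hΨ')).prodMk hsnd
    have hmap := hH.map_nhds_eq_of_surj (LinearMap.range_eq_top.2 fun ab =>
      ⟨(ab.1 + ab.2 • Ψ (t₀ ε), ab.2), by ext <;> simp⟩)
    have hev : ∀ᶠ s in 𝓝 (t₀ ε, (0 : ℝ)), ∃ r : (ι → WSeries) × ℝ, (r.1 - r.2 • Ψ r.1, r.2) = s ∧
        ((∀ i j, ∀ χ : WSeries →ₐ[ℝ] ℝ, (∀ a, ‖χ a‖ ≤ ‖a‖) →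
          χ (gP i j r.1) = P (c 0 + fun i => χ (r.1 i)) (Pi.single j 1) i) ∧
        ∀ i, ∀ χ : WSeries →ₐ[ℝ] ℝ, (∀ a, ‖χ a‖ ≤ ‖a‖) →
          χ (gQ i r.1) = Q (c 0 + fun i => χ (r.1 i)) i) := by
      have h0 : (t₀ ε, (0 : ℝ)) = (t₀ ε - (0 : ℝ) • Ψ (t₀ ε), (0 : ℝ)) := by simp
      rw [h0]
      refine hmap ▸ eventually_map.2 ?_
      filter_upwards [(continuous_fst.tendsto (t₀ ε, (0 : ℝ))).eventually hεt] with r hr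
      exact ⟨r, rfl, hr.2⟩
    have hev' := (((Continuous.prodMk_right (t₀ ε)).tendsto (0 : ℝ)).eventually hev).filter_mono
      (nhdsWithin_le_nhds (s := Set.Ioi 0))
    obtain ⟨δ, ⟨r, hr, hrg⟩, hδ⟩ := (hev'.and self_mem_nhdsWithin).exists
    obtain ⟨h1, h2⟩ := Prod.ext_iff.1 hr
    simp only at h1 h2
    exact ⟨δ, hδ, r.1, by rw [← h2, ← h1, sub_add_cancel], hrg⟩
  have hχ {q : ℝ × ℝ} (hq : ‖q‖ < 1 / 2) (a : WSeries) : ‖evalHom q hq a‖ ≤ ‖a‖ :=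
    ((eval q).le_of_opNorm_le (norm_eval_le hq) a).trans_eq (one_mul _)
  have hev {q : ℝ × ℝ} (hq : ‖q‖ < 1 / 2) (a : WSeries) : HasFDerivAt (fun p => eval p a)
      ((ContinuousLinearMap.apply ℝ ℝ a).comp (fderiv ℝ eval q)) q :=
    (ContinuousLinearMap.apply ℝ ℝ a).hasFDerivAt.comp q
      (analyticAt_eval hq).differentiableAt.hasFDerivAt
  have hevt₀ {q : ℝ × ℝ} (hq : ‖q‖ < 1 / 2) (i : ι) :
      eval q (t₀ ε i) = c (ε * q.1) i - c 0 i := by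
    have h1 := hεc i (evalHom q hq) (hχ hq)
    have h2 := (hgcχ i).self_of_nhds (evalHom q hq) (hχ hq)
    have h3 : evalHom q hq (w ε ()) = ε * q.1 := by
      change eval q (ε • mono (1, 0)) = _
      simp [eval_mono hq]
    simp only [Pi.add_apply, Pi.zero_apply, zero_add, h3, map_zero] at h1 h2
    rw [← h1, ← h2]
    exact map_sub (eval q) _ _
  have hdt₀ {q : ℝ × ℝ} (hq : ‖q‖ < 1 / 2) (i : ι) : fderiv ℝ eval q (0, 1) (t₀ ε i) = 0 := by
    have h1 : HasDerivAt (fun s : ℝ => eval (q + s • ((0 : ℝ), (1 : ℝ))) (t₀ ε i))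
        (fderiv ℝ eval q (0, 1) (t₀ ε i)) 0 := (hev hq (t₀ ε i)).hasLineDerivAt (0, 1)
    refine h1.unique ((hasDerivAt_const (0 : ℝ) (c (ε * q.1) i - c 0 i)).congr_of_eventuallyEq ?_)
    have h2 : Continuous fun s : ℝ => ‖q + s • ((0 : ℝ), (1 : ℝ))‖ := by fun_prop
    have h3 : ∀ᶠ s in 𝓝 (0 : ℝ), ‖q + s • ((0 : ℝ), (1 : ℝ))‖ < 1 / 2 :=
      h2.continuousAt.eventually_lt continuousAt_const (by simpa using hq)
    filter_upwards [h3] with s hs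
    rw [hevt₀ hs]
    simp
  have hti (i : ι) : t i = t₀ ε i + δ • (∑ j, integ (gP i j t) (t j) + integ (gQ i t) (ε • X)) :=
    congr_fun ht i
  set Y : ℝ × ℝ → ι → ℝ := fun q i => c 0 i + eval q (t i) with hY
  have hpde {q : ℝ × ℝ} (hq : ‖q‖ < 1 / 2) (i : ι) : fderiv ℝ eval q (0, 1) (t i) =
      δ * (P (Y q) (fun j => fderiv ℝ eval q (1, 0) (t j)) i + ε * Q (Y q) i) := by
    have h1 (j : ι) : eval q (gP i j t) = P (Y q) (Pi.single j 1) i :=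
      htg.1 i j (evalHom q hq) (hχ hq)
    have h2 : eval q (gQ i t) = Q (Y q) i := htg.2 i (evalHom q hq) (hχ hq)
    have h3 (u : ι → ℝ) : P (Y q) u i = ∑ j, P (Y q) (Pi.single j 1) i * u j := by
      conv_lhs => rw [pi_eq_sum_univ' u]
      simp [mul_comm]
    rw [hti i, map_add, hdt₀ hq, zero_add, map_smul, map_add, map_sum, h3]
    simp only [fderiv_eval_integ hq, h1, h2, map_smul, hX, fderiv_eval_mono hq, smul_eq_mul]
    simp
  have hY0 {x : ℝ} (hx : ‖(x, (0 : ℝ))‖ < 1 / 2) : Y (x, 0) = c (ε * x) := by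
    ext i
    simp only [hY]
    rw [hti i, map_add, map_smul, map_add, map_sum, hevt₀ hx]
    simp [eval_integ_of_snd_eq_zero hx]
  have hYan : AnalyticAt ℝ Y 0 := analyticAt_pi_iff.2 fun i => analyticAt_const.add
    ((analyticAt_eval (by simp)).clm_apply_apply analyticAt_const)
  set S : ℝ × ℝ →L[ℝ] ℝ × ℝ := (ε⁻¹ • ContinuousLinearMap.fst ℝ ℝ ℝ).prod
    ((ε * δ)⁻¹ • ContinuousLinearMap.snd ℝ ℝ ℝ) with hS
  have hSn : ∀ᶠ q in 𝓝 0, ‖S q‖ < 1 / 2 :=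
    S.continuous.norm.continuousAt.eventually_lt continuousAt_const (by simp)
  refine ⟨fun q => Y (S q), hYan.comp_of_eq (S.analyticAt 0) (map_zero S), ?_, ?_⟩
  · filter_upwards [((Continuous.prodMk_left (0 : ℝ)).tendsto (0 : ℝ)).eventually hSn] with x hx
    have : S (x, 0) = (ε⁻¹ * x, 0) := by simp [hS]
    rw [this] at hx ⊢
    rw [hY0 hx, mul_inv_cancel_left₀ hε.ne']
  · filter_upwards [hSn] with q hq
    have h1 : HasFDerivAt (fun q => Y (S q)) (ContinuousLinearMap.pi fun i =>
        ((ContinuousLinearMap.apply ℝ ℝ (t i)).comp (fderiv ℝ eval (S q))).comp S) q :=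
      hasFDerivAt_pi.2 fun i => ((hev hq (t i)).comp q S.hasFDerivAt).const_add _
    have h2 : S (0, 1) = (ε * δ)⁻¹ • (0, 1) := by simp [hS]
    have h3 : S (1, 0) = ε⁻¹ • (1, 0) := by simp [hS]
    have h4 (v : ℝ × ℝ) (j : ι) : fderiv ℝ (fun q => Y (S q)) q v j =
        fderiv ℝ eval (S q) (S v) (t j) := by
      rw [h1.fderiv]; rfl
    have h5 : fderiv ℝ (fun q => Y (S q)) q (1, 0) =
        ε⁻¹ • fun j => fderiv ℝ eval (S q) (1, 0) (t j) := by
      ext j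
      rw [h4, h3, map_smul]
      rfl
    ext i
    rw [h4, h2, map_smul, h5, map_smul, smul_apply, hpde hq]
    simp only [Pi.add_apply, Pi.smul_apply, smul_eq_mul]
    have := hδ.ne'
    field_simp

open Filter Topology in
/-- The Cauchy–Kovalevskaya theorem for a first order quasilinear system in two variables. -/
theorem cauchyKovalevskaya {E : Type*} [NormedAddCommGroup E] [NormedSpace ℝ E]
    [FiniteDimensional ℝ E] {P : E → E →L[ℝ] E} {Q : E → E} {c : ℝ → E}
    (hP : AnalyticAt ℝ P (c 0)) (hQ : AnalyticAt ℝ Q (c 0)) (hc : AnalyticAt ℝ c 0) :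
    ∃ z : ℝ × ℝ → E, AnalyticAt ℝ z 0 ∧ (∀ᶠ x in 𝓝 0, z (x, 0) = c x) ∧
      ∀ᶠ q in 𝓝 0, fderiv ℝ z q (0, 1) = P (z q) (fderiv ℝ z q (1, 0)) + Q (z q) := by
  set e : E ≃L[ℝ] (Fin (Module.finrank ℝ E) → ℝ) :=
    ContinuousLinearEquiv.ofFinrankEq (by simp) with he
  have hsymm : AnalyticAt ℝ e.symm (e (c 0)) := e.symm.analyticAt _
  have hadj : AnalyticAt ℝ (e.arrowCongr e : (E →L[ℝ] E) → _) (P (c 0)) :=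
    (e.arrowCongr e : (E →L[ℝ] E) ≃L[ℝ] _).analyticAt _
  obtain ⟨z, hz, hz0, hzy⟩ := cauchyKovalevskaya_pi
    (P := fun s => e.arrowCongr e (P (e.symm s))) (Q := fun s => e (Q (e.symm s)))
    (c := fun x => e (c x))
    (hadj.comp_of_eq (hP.comp_of_eq hsymm (by simp)) (by simp))
    ((e.analyticAt _).comp (hQ.comp_of_eq hsymm (by simp)))
    ((e.analyticAt _).comp hc)
  refine ⟨fun q => e.symm (z q), (e.symm.analyticAt _).comp hz, ?_, ?_⟩
  · filter_upwards [hz0] with x hx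
    simp [hx]
  · filter_upwards [hzy] with q hq
    have h : fderiv ℝ (fun q => e.symm (z q)) q = (e.symm : _ →L[ℝ] E).comp (fderiv ℝ z q) :=
      e.symm.comp_fderiv
    simp [h, hq]

open Filter Topology in
/-- An analytic vector field has analytic integral curves. -/
theorem exists_analyticAt_hasDerivAt {E : Type*} [NormedAddCommGroup E] [NormedSpace ℝ E]
    [FiniteDimensional ℝ E] {Q : E → E} {p : E} (hQ : AnalyticAt ℝ Q p) :
    ∃ c : ℝ → E, AnalyticAt ℝ c 0 ∧ c 0 = p ∧ ∀ᶠ s in 𝓝 0, HasDerivAt c (Q (c s)) s := by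
  obtain ⟨z, hz, hz0, hzy⟩ := cauchyKovalevskaya (P := fun _ => 0) (c := fun _ => p)
    analyticAt_const hQ analyticAt_const
  have hin : AnalyticAt ℝ (fun s : ℝ => ((0 : ℝ), s)) 0 := analyticAt_const.prod analyticAt_id
  refine ⟨fun s => z (0, s), hz.comp_of_eq hin rfl, hz0.self_of_nhds, ?_⟩
  have h : Tendsto (fun s : ℝ => ((0 : ℝ), s)) (𝓝 0) (𝓝 0) := hin.continuousAt
  filter_upwards [h.eventually hzy, h.eventually hz.eventually_analyticAt] with s hs hs'
  have := hs'.differentiableAt.hasFDerivAt.comp_hasDerivAt s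
    ((hasDerivAt_const s (0 : ℝ)).prodMk (hasDerivAt_id s))
  simpa [hs, Function.comp_def] using this

theorem AnalyticAt.isSymmSndFDerivAt {E G : Type*} [NormedAddCommGroup E] [NormedSpace ℝ E]
    [NormedAddCommGroup G] [NormedSpace ℝ G] [CompleteSpace G] {f : E → G} {x : E}
    (hf : AnalyticAt ℝ f x) : IsSymmSndFDerivAt ℝ f x :=
  hf.contDiffAt.isSymmSndFDerivAt_of_omega

open Filter Topology in
/-- The bracket of two vector fields tangent to all level sets of `φ` is again tangent. -/
theorem fderiv_lieVF_eq_zero {φ : F → ℝ} {X Y : F → F} {q : F} (hφ : AnalyticAt ℝ φ q)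
    (hX : DifferentiableAt ℝ X q) (hY : DifferentiableAt ℝ Y q)
    (hφX : ∀ᶠ s in 𝓝 q, fderiv ℝ φ s (X s) = 0) (hφY : ∀ᶠ s in 𝓝 q, fderiv ℝ φ s (Y s) = 0) :
    fderiv ℝ φ q (lieVF X Y q) = 0 := by
  have h {Z : F → F} (hZ : DifferentiableAt ℝ Z q) (hφZ : ∀ᶠ s in 𝓝 q, fderiv ℝ φ s (Z s) = 0)
      (v : F) : fderiv ℝ φ q (fderiv ℝ Z q v) = -fderiv ℝ (fderiv ℝ φ) q v (Z q) := by
    have h1 := hφ.fderiv.differentiableAt.hasFDerivAt.clm_apply hZ.hasFDerivAt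
    have h2 := h1.unique ((hasFDerivAt_const (0 : ℝ) q).congr_of_eventuallyEq hφZ)
    have h3 := congr($h2 v)
    simp at h3
    linarith
  rw [lieVF, map_sub, h hX hφX, h hY hφY, hφ.isSymmSndFDerivAt (X q) (Y q), sub_self]

open Filter Topology in
theorem fderiv_defect [CompleteSpace F] {L K : F → F →L[ℝ] F} {u w : ℝ × ℝ → F} {q : ℝ × ℝ}
    (hu : AnalyticAt ℝ u q) (hw : DifferentiableAt ℝ w q) (hL : DifferentiableAt ℝ L (u q))
    (hK : DifferentiableAt ℝ K (u q))
    (huy : ∀ᶠ s in 𝓝 q, fderiv ℝ u s (0, 1) = K (u s) (w s))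
    (hwy : L (u q) (fderiv ℝ w q (0, 1)) = fderiv ℝ K (u q) (L (u q) (w q)) (w q) -
      fderiv ℝ L (u q) (K (u q) (w q)) (w q) + K (u q) (fderiv ℝ w q (1, 0))) :
    fderiv ℝ (fun s => fderiv ℝ u s (1, 0) - L (u s) (w s)) q (0, 1) =
      fderiv ℝ K (u q) (fderiv ℝ u q (1, 0) - L (u q) (w q)) (w q) := by
  have hu' := hu.differentiableAt.hasFDerivAt
  have h1 (v : ℝ × ℝ) := hu.fderiv.differentiableAt.hasFDerivAt.clm_apply (hasFDerivAt_const v q)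
  have h2 {N : F → F →L[ℝ] F} (hN : DifferentiableAt ℝ N (u q)) :=
    (hN.hasFDerivAt.comp q hu').clm_apply hw.hasFDerivAt
  have h3 := congr($((h1 (0, 1)).unique ((h2 hK).congr_of_eventuallyEq huy)) (1, 0))
  have h4 := congr($(((h1 (1, 0)).sub (h2 hL)).fderiv) (0, 1))
  have h5 := hu.isSymmSndFDerivAt (0, 1) (1, 0)
  simp at h3 h4
  erw [h4]
  rw [h5, h3, hwy, huy.self_of_nhds]
  simp
  abel

/-- A curve whose velocity annihilates `dφ` stays in a level set of `φ`. -/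
theorem comp_eq_zero_of_hasDerivAt {φ : F → ℝ} {f f' : ℝ → F} {r : ℝ} (hr : 0 < r)
    (hφ : ∀ t ∈ Set.Ioo (-r) r, DifferentiableAt ℝ φ (f t))
    (hf : ∀ t ∈ Set.Ioo (-r) r, HasDerivAt f (f' t) t)
    (h : ∀ t ∈ Set.Ioo (-r) r, fderiv ℝ φ (f t) (f' t) = 0) (h0 : φ (f 0) = 0) {t : ℝ}
    (ht : t ∈ Set.Ioo (-r) r) : φ (f t) = 0 := by
  have hd (s) (hs : s ∈ Set.Ioo (-r) r) : HasDerivAt (fun s => φ (f s)) 0 s := by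
    simpa [h s hs, Function.comp_def] using
      (hφ s hs).hasFDerivAt.comp_hasDerivAt s (hf s hs)
  rw [← h0]
  exact isOpen_Ioo.is_const_of_deriv_eq_zero isPreconnected_Ioo
    (fun s hs => (hd s hs).differentiableAt.differentiableWithinAt)
    (fun s hs => (hd s hs).deriv) ht ⟨by linarith, hr⟩

/-- Solutions of a linear ODE with bounded coefficients vanishing at `0` are zero. -/
theorem eq_zero_of_hasDerivAt_clm {A : ℝ → F →L[ℝ] F} {f : ℝ → F} {r : ℝ} {C : NNReal}
    (hr : 0 < r) (hA : ∀ t ∈ Set.Ioo (-r) r, ‖A t‖₊ ≤ C)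
    (hf : ∀ t ∈ Set.Ioo (-r) r, HasDerivAt f (A t (f t)) t) (h0 : f 0 = 0) {t : ℝ}
    (ht : t ∈ Set.Ioo (-r) r) : f t = 0 :=
  ODE_solution_unique_of_mem_Ioo (v := fun t => A t) (s := fun _ => Set.univ) (K := C)
    (g := fun _ => 0) (fun t ht => ((A t).lipschitz.weaken (hA t ht)).lipschitzOnWith)
    (t₀ := 0) ⟨by linarith, hr⟩ (fun t ht => ⟨hf t ht, trivial⟩)
    (fun t _ => ⟨by simpa using hasDerivAt_const t (0 : F), trivial⟩) h0 ht

theorem lieVF_const_apply {J L : F → F →L[ℝ] F} {q : F} (hJ : DifferentiableAt ℝ J q)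
    (hL : DifferentiableAt ℝ L q) (w : F) :
    lieVF (fun s => L s w) (Jvf J fun s => L s w) q =
      fderiv ℝ (fun s => (J s).comp (L s)) q (L q w) w - fderiv ℝ L q (J q (L q w)) w := by
  have h {N : F → F →L[ℝ] F} (hN : DifferentiableAt ℝ N q) (v : F) :
      fderiv ℝ (fun s => N s w) q v = fderiv ℝ N q v w := by
    rw [(hN.hasFDerivAt.clm_apply (hasFDerivAt_const w q)).fderiv]
    simp
  rw [lieVF, ← h hL, ← h (hJ.clm_comp hL)]
  rfl

open Filter Topology in
/-- Given a family of projections `L` onto the complex tangent spaces whose fields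
`q ↦ L q w` have involutive pairs `X, JX`, every complex tangent vector is tangent to a
`J`-holomorphic disc in `{φ = 0}`. -/
theorem exists_disc [FiniteDimensional ℝ F] {U : Set F} (hU : IsOpen U) {J L : F → F →L[ℝ] F}
    {φ G : F → ℝ} {p v : F} (hJ : AnalyticOnNhd ℝ J U)
    (hJsq : ∀ x ∈ U, (J x).comp (J x) = -ContinuousLinearMap.id ℝ F)
    (hφ : AnalyticOnNhd ℝ φ U) (hL : AnalyticOnNhd ℝ L U) (hG : AnalyticOnNhd ℝ G U)
    (hp : p ∈ U) (hφp : φ p = 0) (hGp : G p ≠ 0)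
    (hLφ : ∀ q ∈ U, ∀ w, fderiv ℝ φ q (L q w) = 0)
    (hLJ : ∀ q ∈ U, ∀ w, fderiv ℝ φ q (J q (L q w)) = 0)
    (hLG : ∀ q ∈ U, ∀ h, fderiv ℝ φ q h = 0 → fderiv ℝ φ q (J q h) = 0 → L q h = G q • h)
    (hlie : ∀ q ∈ U, φ q = 0 → ∀ w,
      fderiv ℝ φ q (lieVF (fun s => L s w) (Jvf J fun s => L s w) q) = 0 ∧
      fderiv ℝ φ q (J q (lieVF (fun s => L s w) (Jvf J fun s => L s w) q)) = 0)
    (hv : fderiv ℝ φ p v = 0) (hvJ : fderiv ℝ φ p (J p v) = 0) :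
    ∃ ρ > (0 : ℝ), ∃ γ : ℂ → F, AnalyticOnNhd ℝ γ (ball 0 ρ) ∧ JHolOn J (ball 0 ρ) γ ∧
      γ 0 = p ∧ deriv (fun t : ℝ => γ t) 0 = v ∧
      ∀ ζ ∈ ball (0 : ℂ) ρ, γ ζ ∈ U ∧ φ (γ ζ) = 0 := by
  have := FiniteDimensional.complete ℝ F
  set K : F → F →L[ℝ] F := fun s => (J s).comp (L s) with hKdef
  have hK : AnalyticOnNhd ℝ K U := fun q hq =>
    ((ContinuousLinearMap.compL ℝ F F F).analyticAt_bilinear (J q, L q)).comp₂ (hJ q hq) (hL q hq)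
  set R : F → F → F := fun q w => fderiv ℝ K q (L q w) w - fderiv ℝ L q (K q w) w with hRdef
  have hR {q : F} (hq : q ∈ U) (hφq : φ q = 0) (w w' : F) :
      L q ((G q)⁻¹ • (K q w' + R q w)) = (G q)⁻¹ • G q • (K q w' + R q w) := by
    obtain ⟨h1, h2⟩ : fderiv ℝ φ q (R q w) = 0 ∧ fderiv ℝ φ q (J q (R q w)) = 0 := by
      have h := hlie q hq hφq w
      rwa [lieVF_const_apply (hJ q hq).differentiableAt (hL q hq).differentiableAt] at h
    rw [map_smul, hLG q hq]
    · rw [map_add, h1, add_zero]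
      exact hLJ q hq w'
    · have h3 : J q (K q w') = -L q w' := congr($(hJsq q hq) (L q w'))
      rw [map_add, map_add, h2, h3, map_neg, hLφ q hq, neg_zero, add_zero]
  set w₀ : F := (G p)⁻¹ • v with hw₀
  obtain ⟨c, hc, hc0, hcd⟩ := exists_analyticAt_hasDerivAt (Q := fun q => L q w₀)
    ((hL p hp).clm_apply_apply analyticAt_const)
  have hfst : AnalyticAt ℝ (Prod.fst : F × F → F) (p, w₀) := analyticAt_fst
  have hsnd : AnalyticAt ℝ (Prod.snd : F × F → F) (p, w₀) := analyticAt_snd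
  have hGinv := ((hG p hp).inv hGp).comp_of_eq hfst rfl
  have hKan := (hK p hp).comp_of_eq hfst rfl
  have hLan := (hL p hp).comp_of_eq hfst rfl
  have hRan : AnalyticAt ℝ (fun z : F × F => R z.1 z.2) (p, w₀) :=
    ((((hK p hp).fderiv.comp_of_eq hfst rfl).clm_apply_apply (hLan.clm_apply_apply
      hsnd)).clm_apply_apply hsnd).sub ((((hL p hp).fderiv.comp_of_eq hfst rfl).clm_apply_apply
        (hKan.clm_apply_apply hsnd)).clm_apply_apply hsnd)
  obtain ⟨z, hz, hz0, hzy⟩ := cauchyKovalevskaya (E := F × F) (c := fun x => (c x, w₀))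
    (P := fun z => (ContinuousLinearMap.inr ℝ F F).comp
      (((G z.1)⁻¹ • K z.1).comp (ContinuousLinearMap.snd ℝ F F)))
    (Q := fun z => (K z.1 z.2, (G z.1)⁻¹ • R z.1 z.2))
    (by
      rw [hc0]
      exact ((ContinuousLinearMap.compL ℝ (F × F) F (F × F)
        (ContinuousLinearMap.inr ℝ F F)).analyticAt _).comp
        ((((ContinuousLinearMap.compL ℝ (F × F) F F).flip
          (ContinuousLinearMap.snd ℝ F F)).analyticAt _).comp (hGinv.smul hKan)))
    (by
      rw [hc0]
      exact (hKan.clm_apply_apply hsnd).prod (hGinv.smul hRan))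
    (hc.prod analyticAt_const)
  set u : ℝ × ℝ → F := fun q => (z q).1 with hudef
  set w : ℝ × ℝ → F := fun q => (z q).2 with hwdef
  have hzz : z 0 = (p, w₀) := by rw [← hc0, ← hz0.self_of_nhds]; rfl
  set A : ℝ × ℝ → F →L[ℝ] F := fun q => (fderiv ℝ K (u q)).flip (w q) with hA
  have hAc : ContinuousAt A 0 := by
    have h1 : AnalyticAt ℝ (fun q => fderiv ℝ K (u q)) 0 :=
      (hK p hp).fderiv.comp_of_eq (analyticAt_fst.comp hz) (by simp [hudef, hzz])
    have h2 : AnalyticAt ℝ w 0 := analyticAt_snd.comp hz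
    exact ((ContinuousLinearMap.flipₗᵢ ℝ F F F).toContinuousLinearEquiv.continuous.continuousAt.comp
      h1.continuousAt).clm_apply h2.continuousAt
  have huc : ContinuousAt u 0 := continuous_fst.continuousAt.comp hz.continuousAt
  have hu0 : u 0 = p := by simp [hudef, hzz]
  obtain ⟨r₁, hr₁, hgood⟩ := Metric.eventually_nhds_iff.1 (hz.eventually_analyticAt.and (hzy.and
    ((huc.eventually_mem (hU.mem_nhds (by rwa [hu0]))).and
    ((((hG p hp).continuousAt.comp_of_eq huc hu0).eventually_ne (by simpa [hu0])).and
    (hAc.nnnorm.eventually_lt_const (lt_add_one _))))))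
  obtain ⟨r₂, hr₂, hgood'⟩ := Metric.eventually_nhds_iff.1 (hz0.and hcd)
  obtain ⟨r, hr, hrr₁, hrr₂⟩ : ∃ r > 0, r ≤ r₁ ∧ r ≤ r₂ :=
    ⟨min r₁ r₂, lt_min hr₁ hr₂, min_le_left _ _, min_le_right _ _⟩
  set I : Set ℝ := Set.Ioo (-r) r with hI
  have h0I : (0 : ℝ) ∈ I := ⟨by linarith, hr⟩
  have hdist {q : ℝ × ℝ} (hq : q ∈ I ×ˢ I) : dist q 0 < r₁ := by
    rw [dist_zero_right, Prod.norm_def]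
    exact max_lt ((abs_lt.2 hq.1).trans_le hrr₁) ((abs_lt.2 hq.2).trans_le hrr₁)
  have hzan {q : ℝ × ℝ} (hq : q ∈ I ×ˢ I) : AnalyticAt ℝ z q := (hgood (hdist hq)).1
  have huan {q : ℝ × ℝ} (hq : q ∈ I ×ˢ I) : AnalyticAt ℝ u q := analyticAt_fst.comp (hzan hq)
  have hwan {q : ℝ × ℝ} (hq : q ∈ I ×ˢ I) : AnalyticAt ℝ w q := analyticAt_snd.comp (hzan hq)
  have huU {q : ℝ × ℝ} (hq : q ∈ I ×ˢ I) : u q ∈ U := (hgood (hdist hq)).2.2.1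
  have hGu {q : ℝ × ℝ} (hq : q ∈ I ×ˢ I) : G (u q) ≠ 0 := (hgood (hdist hq)).2.2.2.1
  have hud {q : ℝ × ℝ} (hq : q ∈ I ×ˢ I) (a : ℝ × ℝ) : fderiv ℝ u q a = (fderiv ℝ z q a).1 := by
    rw [fderiv.fst (hzan hq).differentiableAt]; rfl
  have hwd {q : ℝ × ℝ} (hq : q ∈ I ×ˢ I) (a : ℝ × ℝ) : fderiv ℝ w q a = (fderiv ℝ z q a).2 := by
    rw [fderiv.snd (hzan hq).differentiableAt]; rfl
  have huy {q : ℝ × ℝ} (hq : q ∈ I ×ˢ I) : fderiv ℝ u q (0, 1) = K (u q) (w q) := by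
    rw [hud hq, (hgood (hdist hq)).2.1]
    simp [hudef, hwdef]
  have hwy {q : ℝ × ℝ} (hq : q ∈ I ×ˢ I) : fderiv ℝ w q (0, 1) =
      (G (u q))⁻¹ • (K (u q) (fderiv ℝ w q (1, 0)) + R (u q) (w q)) := by
    rw [hwd hq, (hgood (hdist hq)).2.1, hwd hq]
    simp [hudef, hwdef]
  have hy {f : ℝ × ℝ → F} {x y : ℝ}
      (hf : DifferentiableAt ℝ f (x, y)) :
      HasDerivAt (fun t => f (x, t)) (fderiv ℝ f (x, y) (0, 1)) y :=
    hf.hasFDerivAt.comp_hasDerivAt y ((hasDerivAt_const y x).prodMk (hasDerivAt_id y))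
  have hx {f : ℝ × ℝ → F} {x y : ℝ} (hf : DifferentiableAt ℝ f (x, y)) :
      HasDerivAt (fun t => f (t, y)) (fderiv ℝ f (x, y) (1, 0)) x :=
    hf.hasFDerivAt.comp_hasDerivAt x ((hasDerivAt_id x).prodMk (hasDerivAt_const x y))
  have hzc {x : ℝ} (hx : x ∈ I) : z (x, 0) = (c x, w₀) ∧ HasDerivAt c (L (c x) w₀) x :=
    hgood' (by rw [dist_zero_right]; exact (abs_lt.2 hx).trans_le hrr₂)
  have huxc {x : ℝ} (hx : x ∈ I) : u (x, 0) = c x := by simp [hudef, (hzc hx).1]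
  have hwx0 {x : ℝ} (hx : x ∈ I) : w (x, 0) = w₀ := by simp [hwdef, (hzc hx).1]
  have hcU {x : ℝ} (hx : x ∈ I) : c x ∈ U := huxc hx ▸ huU ⟨hx, h0I⟩
  have hφc {x : ℝ} (hx : x ∈ I) : φ (c x) = 0 :=
    comp_eq_zero_of_hasDerivAt hr (fun t ht => (hφ _ (hcU ht)).differentiableAt)
      (fun t ht => (hzc ht).2) (fun t ht => hLφ _ (hcU ht) _) (by rw [hc0, hφp]) hx
  have hφu {q : ℝ × ℝ} (hq : q ∈ I ×ˢ I) : φ (u q) = 0 :=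
    comp_eq_zero_of_hasDerivAt (f := fun t => u (q.1, t))
      (f' := fun t => K (u (q.1, t)) (w (q.1, t))) hr
      (fun t ht => (hφ _ (huU (q := (q.1, t)) ⟨hq.1, ht⟩)).differentiableAt)
      (fun t ht => by
        rw [← huy (q := (q.1, t)) ⟨hq.1, ht⟩]
        exact hy (huan (q := (q.1, t)) ⟨hq.1, ht⟩).differentiableAt)
      (fun t ht => hLJ _ (huU (q := (q.1, t)) ⟨hq.1, ht⟩) _)
      ((congrArg φ (huxc hq.1)).trans (hφc hq.1)) hq.2
  set D : ℝ × ℝ → F := fun q => fderiv ℝ u q (1, 0) - L (u q) (w q) with hD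
  have hopen : IsOpen (I ×ˢ I) := isOpen_Ioo.prod isOpen_Ioo
  have hDy {q : ℝ × ℝ} (hq : q ∈ I ×ˢ I) : fderiv ℝ D q (0, 1) = A q (D q) := by
    refine fderiv_defect (huan hq) (hwan hq).differentiableAt (hL _ (huU hq)).differentiableAt
      (hK _ (huU hq)).differentiableAt ?_ ?_
    · filter_upwards [hopen.mem_nhds hq] with s hs using huy hs
    · rw [hwy hq, hR (huU hq) (hφu hq), inv_smul_smul₀ (hGu hq), add_comm]
  have hDan {q : ℝ × ℝ} (hq : q ∈ I ×ˢ I) : DifferentiableAt ℝ D q :=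
    (((huan hq).fderiv.clm_apply_apply analyticAt_const).sub
      (((hL _ (huU hq)).comp (huan hq)).clm_apply_apply (hwan hq))).differentiableAt
  have hD0 {x : ℝ} (hxI : x ∈ I) : D (x, 0) = 0 := by
    have h1 : HasDerivAt (fun t => u (t, 0)) (L (c x) w₀) x :=
      (hzc hxI).2.congr_of_eventuallyEq (by
        filter_upwards [isOpen_Ioo.mem_nhds hxI] with t ht using huxc ht)
    simp only [hD]
    rw [(hx (huan ⟨hxI, h0I⟩).differentiableAt).unique h1, huxc hxI, hwx0 hxI, sub_self]
  have hux {q : ℝ × ℝ} (hq : q ∈ I ×ˢ I) : fderiv ℝ u q (1, 0) = L (u q) (w q) :=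
    sub_eq_zero.1 <| eq_zero_of_hasDerivAt_clm (f := fun t => D (q.1, t))
      (A := fun t => A (q.1, t)) hr
      (fun t ht => (hgood (hdist (q := (q.1, t)) ⟨hq.1, ht⟩)).2.2.2.2.le)
      (fun t ht => by
        rw [← hDy (q := (q.1, t)) ⟨hq.1, ht⟩]
        exact hy (hDan (q := (q.1, t)) ⟨hq.1, ht⟩)) (hD0 hq.1) hq.2
  set S : ℂ →L[ℝ] ℝ × ℝ := Complex.equivRealProdCLM.toContinuousLinearMap with hS
  have hSI {ζ : ℂ} (hζ : ζ ∈ ball 0 r) : S ζ ∈ I ×ˢ I := by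
    rw [mem_ball_zero_iff] at hζ
    exact ⟨abs_lt.1 ((Complex.abs_re_le_norm ζ).trans_lt hζ),
      abs_lt.1 ((Complex.abs_im_le_norm ζ).trans_lt hζ)⟩
  refine ⟨r, hr, fun ζ => u (S ζ), fun ζ hζ => (huan (hSI hζ)).comp (S.analyticAt ζ), ?_,
    by simpa using hu0, ?_, fun ζ hζ => ⟨huU (hSI hζ), hφu (hSI hζ)⟩⟩
  · intro ζ hζ a
    have hq := hSI hζ
    have h1 (a : ℂ) : fderiv ℝ (fun ζ => u (S ζ)) ζ a =
        a.re • L (u (S ζ)) (w (S ζ)) + a.im • J (u (S ζ)) (L (u (S ζ)) (w (S ζ))) := by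
      have h2 : S a = a.re • (1, 0) + a.im • (0, 1) := by simp [hS]
      have h3 := ((huan hq).differentiableAt.hasFDerivAt.comp ζ S.hasFDerivAt).fderiv
      change fderiv ℝ (u ∘ S) ζ a = _
      rw [h3, ContinuousLinearMap.comp_apply, h2, map_add, map_smul, map_smul, hux hq, huy hq]
      rfl
    have h4 (b : F) : J (u (S ζ)) (J (u (S ζ)) b) = -b := congr($(hJsq _ (huU hq)) b)
    rw [h1, h1, map_add, map_smul, map_smul, h4]
    simp
    abel
  · have h1 : HasDerivAt (fun t : ℝ => u (S t)) (L p w₀) 0 := by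
      have h2 := hx (x := 0) (y := 0) (huan ⟨h0I, h0I⟩).differentiableAt
      rw [hux ⟨h0I, h0I⟩, huxc h0I, hwx0 h0I, hc0] at h2
      simpa [hS] using h2
    rw [h1.deriv, hw₀, map_smul, hLG p hp v hv hvJ, inv_smul_smul₀ hGp]

/-- `(α a β b - α b β a)` times the projection onto `ker α ∩ ker β` along the span of `a, b`. -/
def kerProj (α β : F →L[ℝ] ℝ) (a b : F) : F →L[ℝ] F :=
  (α a * β b - α b * β a) • ContinuousLinearMap.id ℝ F -
    (ContinuousLinearMap.smulRightL ℝ F F (β b • α - α b • β) a +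
      ContinuousLinearMap.smulRightL ℝ F F (α a • β - β a • α) b)

theorem kerProj_apply (α β : F →L[ℝ] ℝ) (a b w : F) :
    kerProj α β a b w = (α a * β b - α b * β a) • w -
      ((β b * α w - α b * β w) • a + (α a * β w - β a * α w) • b) := by
  simp [kerProj, sub_smul, mul_smul]

theorem left_kerProj (α β : F →L[ℝ] ℝ) (a b w : F) : α (kerProj α β a b w) = 0 := by
  simp only [kerProj_apply, map_sub, map_add, map_smul, smul_eq_mul]
  ring

theorem right_kerProj (α β : F →L[ℝ] ℝ) (a b w : F) : β (kerProj α β a b w) = 0 := by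
  simp only [kerProj_apply, map_sub, map_add, map_smul, smul_eq_mul]
  ring

theorem kerProj_apply_of_eq_zero {α β : F →L[ℝ] ℝ} {a b w : F} (hα : α w = 0) (hβ : β w = 0) :
    kerProj α β a b w = (α a * β b - α b * β a) • w := by
  simp [kerProj_apply, hα, hβ]

theorem AnalyticAt.kerProj {E : Type*} [NormedAddCommGroup E] [NormedSpace ℝ E]
    {α β : E → F →L[ℝ] ℝ} {x : E} (hα : AnalyticAt ℝ α x) (hβ : AnalyticAt ℝ β x) (a b : F) :
    AnalyticAt ℝ (fun q => kerProj (α q) (β q) a b) x := by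
  have hc (v : F) {γ : E → F →L[ℝ] ℝ} (hγ : AnalyticAt ℝ γ x) : AnalyticAt ℝ (fun q => γ q v) x :=
    hγ.clm_apply_apply analyticAt_const
  have hs (v : F) {γ : E → F →L[ℝ] ℝ} (hγ : AnalyticAt ℝ γ x) :
      AnalyticAt ℝ (fun q => ContinuousLinearMap.smulRightL ℝ F F (γ q) v) x :=
    (((ContinuousLinearMap.smulRightL ℝ F F).analyticAt _).comp hγ).clm_apply_apply analyticAt_const
  exact ((((hc a hα).mul (hc b hβ)).sub ((hc b hα).mul (hc a hβ))).smul analyticAt_const).sub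
    ((hs a (((hc b hβ).smul hα).sub ((hc b hα).smul hβ))).add
      (hs b (((hc a hα).smul hβ).sub ((hc a hβ).smul hα))))

open Filter in
/-- Discs in Levi-flat hypersurfaces through a given point with prescribed tangent vector. -/
theorem exists_disc_of_leviFlat [FiniteDimensional ℝ F] {U : Set F} (hU : IsOpen U)
    {J : F → F →L[ℝ] F} (hJ : AnalyticOnNhd ℝ J U)
    (hJsq : ∀ x ∈ U, (J x).comp (J x) = -ContinuousLinearMap.id ℝ F)
    {φ : F → ℝ} (hφ : AnalyticOnNhd ℝ φ U)
    (hflat : ∀ X Y : F → F, AnalyticOnNhd ℝ X U → AnalyticOnNhd ℝ Y U →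
      InTJM J φ U X → InTJM J φ U Y → ∀ q ∈ U, φ q = 0 → levihat J φ X Y q = 0)
    {p v : F} (hp : p ∈ U) (hφp : φ p = 0) (hdφ : fderiv ℝ φ p ≠ 0)
    (hv : fderiv ℝ φ p v = 0) (hvJ : fderiv ℝ φ p (J p v) = 0) :
    ∃ ρ > (0 : ℝ), ∃ γ : ℂ → F, AnalyticOnNhd ℝ γ (ball 0 ρ) ∧ JHolOn J (ball 0 ρ) γ ∧
      γ 0 = p ∧ deriv (fun t : ℝ => γ t) 0 = v ∧
      ∀ ζ ∈ ball (0 : ℂ) ρ, γ ζ ∈ U ∧ φ (γ ζ) = 0 := by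
  have := FiniteDimensional.complete ℝ F
  obtain ⟨a, ha⟩ : ∃ a, fderiv ℝ φ p a ≠ 0 := by
    by_contra! h
    exact hdφ (ContinuousLinearMap.ext h)
  set α : F → F →L[ℝ] ℝ := fderiv ℝ φ with hαdef
  set β : F → F →L[ℝ] ℝ := fun q => (α q).comp (J q) with hβdef
  set b : F := J p a with hb
  have hα : AnalyticOnNhd ℝ α U := hφ.fderiv
  have hβ : AnalyticOnNhd ℝ β U := fun q hq =>
    ((ContinuousLinearMap.compL ℝ F F ℝ).analyticAt_bilinear (α q, J q)).comp₂ (hα q hq) (hJ q hq)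
  set L : F → F →L[ℝ] F := fun q => kerProj (α q) (β q) a b with hLdef
  have hL : AnalyticOnNhd ℝ L U := fun q hq => (hα q hq).kerProj (hβ q hq) a b
  have hLα (q w : F) : α q (L q w) = 0 := left_kerProj _ _ _ _ _
  have hLβ (q w : F) : α q (J q (L q w)) = 0 := right_kerProj (α q) (β q) a b w
  have hLw (w : F) : AnalyticOnNhd ℝ (fun s => L s w) U := fun q hq =>
    (hL q hq).clm_apply_apply analyticAt_const
  have hc (v : F) {γ : F → F →L[ℝ] ℝ} (hγ : AnalyticOnNhd ℝ γ U) :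
      AnalyticOnNhd ℝ (fun q => γ q v) U := fun q hq => (hγ q hq).clm_apply_apply analyticAt_const
  refine exists_disc hU (G := fun q => α q a * β q b - α q b * β q a) hJ hJsq hφ hL
    (((hc a hα).mul (hc b hβ)).sub ((hc b hα).mul (hc a hβ))) hp hφp ?_
    (fun q _ => hLα q) (fun q _ => hLβ q) (fun q _ h h1 h2 => kerProj_apply_of_eq_zero h1 h2)
    (fun q hq hφq w => ⟨?_, ?_⟩) hv hvJ
  · have h1 : β p b = -α p a := by
      simpa [hb, hβdef] using congrArg (fun T => α p (T a)) (hJsq p hp)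
    have h2 : α p b = β p a := rfl
    simp only [h1, h2]
    have : 0 < α p a * α p a := mul_self_pos.2 ha
    nlinarith [mul_self_nonneg (β p a)]
  · exact fderiv_lieVF_eq_zero (hφ q hq) (hLw w q hq).differentiableAt
      ((hJ q hq).clm_apply_apply (hLw w q hq)).differentiableAt
      (Eventually.of_forall fun s => hLα s w) (Eventually.of_forall fun s => hLβ s w)
  · have hT : InTJM J φ U (fun s => L s w) := fun s _ _ => ⟨hLα s w, hLβ s w⟩
    have h := congrArg Complex.re (hflat _ _ (hLw w) (hLw w) hT hT q hq hφq)
    simp only [levihat, map_add, Complex.add_re, Complex.ofReal_re, Complex.mul_re, Complex.I_re,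
      Complex.I_im, Complex.ofReal_im, Complex.zero_re] at h
    linarith

/-- Theorem 4.9, Kruzhilin–Sukhov in the real analytic case: discs in
Levi-flat hypersurfaces with prescribed tangent vector. -/
theorem stmt5 (n : ℕ) (U : Set (Ecx n)) (hU : IsOpen U) (h0U : (0 : Ecx n) ∈ U)
    (J : Ecx n → Ecx n →L[ℝ] Ecx n) (hJan : AnalyticOnNhd ℝ J U)
    (hJsq : ∀ x ∈ U, (J x).comp (J x) = -ContinuousLinearMap.id ℝ (Ecx n))
    (hJ0 : J 0 = J0 n)
    (φ : Ecx n → ℝ) (hφan : AnalyticOnNhd ℝ φ U) (hφ0 : φ 0 = 0)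
    (hdφ : ∀ q ∈ U, φ q = 0 → fderiv ℝ φ q ≠ 0)
    (hflat : ∀ X Y : Ecx n → Ecx n, AnalyticOnNhd ℝ X U → AnalyticOnNhd ℝ Y U →
      InTJM J φ U X → InTJM J φ U Y → ∀ q ∈ U, φ q = 0 → levihat J φ X Y q = 0) :
    ∃ V ∈ nhds (0 : Ecx n), ∀ p ∈ V, φ p = 0 →
      ∀ v : Ecx n, fderiv ℝ φ p v = 0 → fderiv ℝ φ p (J p v) = 0 →
        ∃ ρ > (0 : ℝ), ∃ γ : ℂ → Ecx n,
          AnalyticOnNhd ℝ γ (ball 0 ρ) ∧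
          JHolOn J (ball 0 ρ) γ ∧
          γ 0 = p ∧
          deriv (fun t : ℝ => γ t) 0 = v ∧
          (∀ ζ ∈ ball (0 : ℂ) ρ, γ ζ ∈ U ∧ φ (γ ζ) = 0) := by
  exact ⟨U, hU.mem_nhds h0U, fun p hp hφp v hv hvJ =>
    exists_disc_of_leviFlat hU hJan hJsq hφan hflat hp hφp (hdφ p hp hφp) hv hvJ⟩
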